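/- arXiv:1509.03230 — 2 statements merged into one kernel-verified Lean document; each statement's English description precedes it below -/
import Mathlib

section
/- Let n ≥ 1 and let w be a rational point lying in the open cube (0,1)^n. Then the germinal MV-algebra A_w = McN([0,1]^n)/𝔬_w at w is hopfian: every surjective MV-endomorphism of A_w is injective. -/
open Set BigOperators

/-- The unit cube `[0,1]^n` as a subset of `Fin n → ℝ`. -/
def cube (n : ℕ) : Set (Fin n → ℝ) := Set.Icc 0 1

/-- An (affine) linear polynomial with integer coefficients. -/
def IsAffineZ {n : ℕ} (p : (Fin n → ℝ) → ℝ) : Prop :=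
  ∃ (m : ℤ) (c : Fin n → ℤ), ∀ x, p x = (m : ℝ) + ∑ i, (c i : ℝ) * x i

/-- A McNaughton function on `[0,1]^n`: continuous, `[0,1]`-valued, and agreeing at each
point of the cube with one of finitely many affine polynomials with integer coefficients. -/
def IsMcNaughton {n : ℕ} (f : (Fin n → ℝ) → ℝ) : Prop :=
  ContinuousOn f (cube n) ∧ (∀ x ∈ cube n, f x ∈ Set.Icc (0:ℝ) 1) ∧
  ∃ (u : ℕ) (p : Fin u → (Fin n → ℝ) → ℝ),
    (∀ j, IsAffineZ (p j)) ∧ ∀ x ∈ cube n, ∃ j, f x = p j x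

/-- `McN X`: restrictions to `X` of McNaughton functions on `[0,1]^n`. -/
def McN {n : ℕ} (X : Set (Fin n → ℝ)) : Set (↥X → ℝ) :=
  {g : ↥X → ℝ | ∃ f, IsMcNaughton (n := n) f ∧ ∀ x : X, g x = f x.1}

/-- Pointwise MV-negation `¬f = 1 - f`. -/
def mvNeg {α : Type*} (f : α → ℝ) : α → ℝ := fun x => 1 - f x

/-- Pointwise MV-sum `f ⊕ g = min(1, f + g)`. -/
def mvOplus {α : Type*} (f g : α → ℝ) : α → ℝ := fun x => min 1 (f x + g x)

/-- A point all of whose coordinates are rational. -/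
def IsRationalPoint {n : ℕ} (x : Fin n → ℝ) : Prop := ∀ i, ∃ q : ℚ, x i = (q : ℝ)

/-- An MV-endomorphism of `McN X`. -/
def IsMVEndo {n : ℕ} (X : Set (Fin n → ℝ)) (σ : (↥X → ℝ) → (↥X → ℝ)) : Prop :=
  Set.MapsTo σ (McN X) (McN X) ∧
  σ (fun _ => 0) = (fun _ => 0) ∧
  (∀ f ∈ McN X, σ (mvNeg f) = mvNeg (σ f)) ∧
  (∀ f ∈ McN X, ∀ g ∈ McN X, σ (mvOplus f g) = mvOplus (σ f) (σ g))

/-- `f` and `g` have the same germ at `w`: they agree on some open neighborhood of `w`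
(relative to the cube). -/
def germEq {n : ℕ} (w : Fin n → ℝ) (f g : ↥(cube n) → ℝ) : Prop :=
  ∃ U : Set (Fin n → ℝ), IsOpen U ∧ w ∈ U ∧ ∀ x : ↥(cube n), x.1 ∈ U → f x = g x

/-- A continuous function on `[0,1]` with finitely many affine pieces has a piece lying
above it at `0` and below it at `1`. -/
theorem exists_piece_ge_zero_le_one {ι : Type*} [Finite ι] {g : ℝ → ℝ}
    (hg : ContinuousOn g (Icc 0 1)) (α β : ι → ℝ)
    (hp : ∀ t ∈ Icc (0:ℝ) 1, ∃ j, g t = α j + β j * t) :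
    ∃ j, g 0 ≤ α j ∧ α j + β j ≤ g 1 := by
  classical
  set S : Set ℝ := {t | t ∈ Icc (0:ℝ) 1 ∧ ∃ j, g 0 ≤ α j ∧ α j + β j * t ≤ g t} with hS
  have hS_eq : S = ⋃ j ∈ {j | g 0 ≤ α j}, {t | t ∈ Icc (0:ℝ) 1 ∧ α j + β j * t ≤ g t} := by
    ext t; simp only [hS, mem_ofPred_eq, mem_iUnion]; tauto
  have hclosed : IsClosed S := by
    rw [hS_eq]
    refine (Set.toFinite _).isClosed_biUnion fun j _ => ?_
    exact isClosed_Icc.isClosed_le (by fun_prop) hg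
  have h0 : (0:ℝ) ∈ S := by
    obtain ⟨j, hj⟩ := hp 0 (by simp)
    simp only [mul_zero, add_zero] at hj
    exact ⟨by simp, j, hj.le, by simp [hj]⟩
  have hbdd : BddAbove S := ⟨1, fun t ht => ht.1.2⟩
  set s := sSup S with hs
  have hsS : s ∈ S := hclosed.csSup_mem ⟨0, h0⟩ hbdd
  obtain ⟨hs01, j, hj0, hjs⟩ := hsS
  rcases hs01.2.eq_or_lt with h1 | h1
  · exact ⟨j, hj0, by simpa [h1] using hjs⟩
  exfalso
  have habove : ∀ t ∈ Ioc s 1, ∀ i, g 0 ≤ α i → g t < α i + β i * t := by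
    intro t ht i hi
    by_contra! hcon
    have : t ≤ s := le_csSup hbdd ⟨⟨hs01.1.trans ht.1.le, ht.2⟩, i, hi, hcon⟩
    exact absurd ht.1 (not_lt.2 this)
  have hcont : Filter.Tendsto g (nhdsWithin s (Ioc s 1)) (nhds (g s)) :=
    ((hg s hs01).mono fun t ht => ⟨hs01.1.trans ht.1.le, ht.2⟩)
  have hne : (nhdsWithin s (Ioc s 1)).NeBot := by
    rw [nhdsWithin_Ioc_eq_nhdsGT h1]; infer_instance
  have haff : ∀ i, Filter.Tendsto (fun t => α i + β i * t) (nhdsWithin s (Ioc s 1))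
      (nhds (α i + β i * s)) := fun i =>
    (Continuous.tendsto (by fun_prop : Continuous fun t : ℝ => α i + β i * t) s).mono_left
      nhdsWithin_le_nhds
  have hjs' : α j + β j * s = g s := by
    refine le_antisymm hjs (le_of_tendsto_of_tendsto hcont (haff j) ?_)
    filter_upwards [self_mem_nhdsWithin] with t ht using (habove t ht j hj0).le
  have hev : ∀ᶠ t in nhdsWithin s (Ioc s 1),
      ∀ i, α i + β i * s ≠ g s → α i + β i * t ≠ g t := by
    rw [Filter.eventually_all]
    intro i
    by_cases h : α i + β i * s = g s
    · exact Filter.Eventually.of_forall fun t h' => absurd h h'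
    · filter_upwards [((haff i).sub hcont).eventually_ne (sub_ne_zero.2 h)] with t ht _
        using sub_ne_zero.1 ht
  obtain ⟨t, hti, hts⟩ := (hev.and self_mem_nhdsWithin).exists
  obtain ⟨k, hk⟩ := hp t ⟨hs01.1.trans hts.1.le, hts.2⟩
  have hks : α k + β k * s = g s := by
    by_contra h
    exact hti k h hk.symm
  have h2 := habove t hts j hj0
  have h3 : ¬ g 0 ≤ α k := fun h => (habove t hts k h).ne hk
  have h4 : β k < β j := by
    have : (β k - β j) * (t - s) < 0 := by nlinarith
    nlinarith [hts.1]
  apply h3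
  nlinarith [hs01.1]

/-- The MV-algebra of functions on the cube generated by the coordinate functions. -/
inductive MVGen {n : ℕ} : (↥(cube n) → ℝ) → Prop
  | zero : MVGen fun _ => 0
  | coord (i : Fin n) : MVGen fun x => x.1 i
  | neg {f} : MVGen f → MVGen (mvNeg f)
  | oplus {f g} : MVGen f → MVGen g → MVGen (mvOplus f g)

namespace MVGen

variable {n : ℕ} {f g : ↥(cube n) → ℝ}

theorem mem_Icc (hf : MVGen f) (x : ↥(cube n)) : f x ∈ Icc (0:ℝ) 1 := by
  induction hf with
  | zero => simp
  | coord i => exact ⟨x.2.1 i, x.2.2 i⟩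
  | neg _ ih => simp only [mvNeg, Set.mem_Icc] at *; constructor <;> linarith
  | oplus _ _ ih₁ ih₂ =>
    simp only [mvOplus, Set.mem_Icc] at *
    exact ⟨le_min zero_le_one (by linarith), min_le_left _ _⟩

theorem one : MVGen (n := n) fun _ => 1 := by
  convert (zero (n := n)).neg using 1
  ext; simp [mvNeg]

theorem odot (hf : MVGen f) (hg : MVGen g) : MVGen fun x => max 0 (f x + g x - 1) := by
  convert (hf.neg.oplus hg.neg).neg using 1
  ext x
  simp only [mvNeg, mvOplus]
  grind

theorem inf (hf : MVGen f) (hg : MVGen g) : MVGen fun x => min (f x) (g x) := by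
  convert hf.odot (hf.neg.oplus hg) using 1
  ext x
  have h1 := hf.mem_Icc x
  have h2 := hg.mem_Icc x
  simp only [mvNeg, mvOplus, Set.mem_Icc] at *
  grind

theorem sup (hf : MVGen f) (hg : MVGen g) : MVGen fun x => max (f x) (g x) := by
  convert (hf.neg.inf hg.neg).neg using 1
  ext x
  simp only [mvNeg]
  grind

theorem exists_finset_inf {ι : Type*} (T : ι → ↥(cube n) → ℝ) (hT : ∀ j, MVGen (T j))
    (s : Finset ι) : ∃ g, MVGen g ∧ ∀ x, (∀ j ∈ s, g x ≤ T j x) ∧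
      (g x = 1 ∨ ∃ j ∈ s, g x = T j x) := by
  classical
  induction s using Finset.induction_on with
  | empty => exact ⟨_, one, by simp⟩
  | insert a s _ ih =>
    obtain ⟨g, hg, h⟩ := ih
    refine ⟨_, (hT a).inf hg, fun x => ⟨fun j hj => ?_, ?_⟩⟩
    · rcases Finset.mem_insert.1 hj with rfl | hj
      · exact min_le_left _ _
      · exact (min_le_right _ _).trans ((h x).1 j hj)
    · rcases min_choice (T a x) (g x) with h' | h' <;> rw [h']
      · exact Or.inr ⟨a, by simp, rfl⟩
      · rcases (h x).2 with h2 | ⟨j, hj, h2⟩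
        · exact Or.inl h2
        · exact Or.inr ⟨j, by simp [hj], h2⟩

theorem exists_finset_sup {ι : Type*} (T : ι → ↥(cube n) → ℝ) (hT : ∀ j, MVGen (T j))
    (s : Finset ι) : ∃ g, MVGen g ∧ ∀ x, (∀ j ∈ s, T j x ≤ g x) ∧
      (g x = 0 ∨ ∃ j ∈ s, g x = T j x) := by
  obtain ⟨g, hg, h⟩ := exists_finset_inf (fun j => mvNeg (T j)) (fun j => (hT j).neg) s
  refine ⟨_, hg.neg, fun x => ⟨fun j hj => ?_, ?_⟩⟩
  · have := (h x).1 j hj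
    simp only [mvNeg] at *
    linarith
  · rcases (h x).2 with h2 | ⟨j, hj, h2⟩
    · exact Or.inl (by simp [mvNeg, h2])
    · exact Or.inr ⟨j, hj, by simp [mvNeg, h2]⟩

theorem trunc_add_coord {p : ↥(cube n) → ℝ}
    (hp : ∀ m : ℤ, MVGen fun x => max 0 (min 1 (p x + m))) (i : Fin n) (m : ℤ) :
    MVGen fun x => max 0 (min 1 (p x + x.1 i + m)) := by
  convert ((hp m).oplus (coord i)).odot (hp (m + 1)) using 1
  ext x
  have h1 : 0 ≤ x.1 i := x.2.1 i
  have h2 : x.1 i ≤ 1 := x.2.2 i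
  simp only [mvOplus]
  push_cast
  grind

theorem trunc_neg {p : ↥(cube n) → ℝ}
    (hp : ∀ m : ℤ, MVGen fun x => max 0 (min 1 (p x + m))) (m : ℤ) :
    MVGen fun x => max 0 (min 1 (-p x + m)) := by
  convert (hp (1 - m)).neg using 1
  ext x
  simp only [mvNeg]
  push_cast
  grind

theorem trunc_add_int_mul_coord {p : ↥(cube n) → ℝ}
    (hp : ∀ m : ℤ, MVGen fun x => max 0 (min 1 (p x + m))) (i : Fin n) (k : ℤ) :
    ∀ m : ℤ, MVGen fun x => max 0 (min 1 (p x + k * x.1 i + m)) := by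
  induction k using Int.induction_on with
  | zero => simpa using hp
  | succ k ih =>
    intro m
    convert trunc_add_coord ih i m using 4
    push_cast; ring_nf
  | pred k ih =>
    intro m
    convert trunc_neg (trunc_add_coord (trunc_neg ih) i) m using 4
    push_cast; ring_nf

theorem trunc_affine (c : Fin n → ℤ) (m : ℤ) :
    MVGen fun x : ↥(cube n) => max 0 (min 1 ((m : ℝ) + ∑ i, (c i : ℝ) * x.1 i)) := by
  suffices h : ∀ s : Finset (Fin n), ∀ m : ℤ,
      MVGen fun x : ↥(cube n) => max 0 (min 1 (∑ i ∈ s, (c i : ℝ) * x.1 i + m)) by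
    simpa only [add_comm] using h Finset.univ m
  intro s
  classical
  induction s using Finset.induction_on with
  | empty =>
    intro m
    rcases le_or_gt m 0 with hm | hm
    · convert zero using 2
      have : (m : ℝ) ≤ 0 := by exact_mod_cast hm
      grind
    · convert one using 2
      have : (1 : ℝ) ≤ m := by exact_mod_cast hm
      grind
  | insert a s ha ih =>
    intro m
    convert trunc_add_int_mul_coord ih a (c a) m using 4
    rw [Finset.sum_insert ha]; ring

end MVGen

/-- The hard half of McNaughton's theorem. -/
theorem mvGen_of_mem_McN {n : ℕ} {f : ↥(cube n) → ℝ} (hf : f ∈ McN (cube n)) : MVGen f := by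
  classical
  obtain ⟨F, ⟨hcont, hF01, u, p, hp, hpF⟩, hfF⟩ := hf
  choose m c hpc using hp
  have hconv : Convex ℝ (cube n) := convex_Icc 0 1
  set T : Fin u → ↥(cube n) → ℝ :=
    fun j x => max 0 (min 1 ((m j : ℝ) + ∑ i, (c j i : ℝ) * x.1 i)) with hTdef
  have hT : ∀ j, MVGen (T j) := fun j => MVGen.trunc_affine (c j) (m j)
  have hTp : ∀ j x, T j x = max 0 (min 1 (p j x.1)) := fun j x => by rw [hpc]
  choose G hG hGT using MVGen.exists_finset_inf T hT
  set 𝒮 : Finset (Finset (Fin u)) := Finset.univ.filter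
    fun s => ∃ a : ↥(cube n), s = Finset.univ.filter fun j => F a.1 ≤ p j a.1
  obtain ⟨h, hh, hhG⟩ := MVGen.exists_finset_sup G hG 𝒮
  convert hh using 1
  ext x
  have hx01 := hF01 x.1 x.2
  rw [hfF]
  apply le_antisymm
  · refine le_trans ?_ ((hhG x).1 (Finset.univ.filter fun j => F x.1 ≤ p j x.1)
      (by simp only [𝒮, Finset.mem_filter_univ]; exact ⟨x, rfl⟩))
    rcases (hGT (Finset.univ.filter fun j => F x.1 ≤ p j x.1) x).2 with h1 | ⟨j, hj, h1⟩
    · rw [h1]; exact hx01.2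
    · rw [h1, hTp]
      exact le_max_of_le_right (le_min hx01.2 (by simpa using hj))
  · rcases (hhG x).2 with h0 | ⟨s, hs, h1⟩
    · rw [h0]; exact hx01.1
    · rw [h1]
      simp only [𝒮, Finset.mem_filter_univ] at hs
      obtain ⟨a, rfl⟩ := hs
      have hseg : ∀ t ∈ Icc (0:ℝ) 1, a.1 + t • (x.1 - a.1) ∈ cube n := fun t ht =>
        hconv.add_smul_sub_mem a.2 x.2 ht
      obtain ⟨j, hj0, hj1⟩ := exists_piece_ge_zero_le_one
        (g := fun t => F (a.1 + t • (x.1 - a.1)))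
        (hcont.comp (by fun_prop) hseg)
        (fun j => p j a.1) (fun j => p j x.1 - p j a.1) (fun t ht => by
          obtain ⟨j, hj⟩ := hpF _ (hseg t ht)
          refine ⟨j, ?_⟩
          simp only [hj, hpc, Pi.add_apply, Pi.smul_apply, Pi.sub_apply, smul_eq_mul]
          rw [add_sub_add_left_eq_sub, ← Finset.sum_sub_distrib, Finset.sum_mul, add_assoc,
            ← Finset.sum_add_distrib]
          congr 1
          exact Finset.sum_congr rfl fun i _ => by ring)
      simp only [zero_smul, add_zero, one_smul, add_sub_cancel] at hj0 hj1
      refine ((hGT _ x).1 j (by simpa using hj0)).trans ?_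
      rw [hTp]
      exact max_le hx01.1 ((min_le_right _ _).trans hj1)

/-- The locus where two affine maps agree. -/
def affineEqLocus {E : Type*} [AddCommGroup E] [Module ℝ E] (A B : E →ᵃ[ℝ] E) :
    AffineSubspace ℝ E where
  carrier := {x | A x = B x}
  smul_vsub_vadd_mem' c p₁ p₂ p₃ h₁ h₂ h₃ := by
    simp only [Set.mem_ofPred_eq] at *
    simp only [AffineMap.map_vadd, map_smul, AffineMap.linearMap_vsub, h₁, h₂, h₃]

section PiecewiseAffine

open Module Metric Topology Filter

theorem mem_affineEqLocus {E : Type*} [AddCommGroup E] [Module ℝ E] {A B : E →ᵃ[ℝ] E} {x : E} :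
    x ∈ affineEqLocus A B ↔ A x = B x := Iff.rfl

theorem affineEqLocus_ne_top {E : Type*} [AddCommGroup E] [Module ℝ E] {A B : E →ᵃ[ℝ] E}
    (h : A ≠ B) : affineEqLocus A B ≠ ⊤ := by
  intro htop
  refine h (AffineMap.ext fun x => ?_)
  rw [← mem_affineEqLocus, htop]
  trivial

theorem affineSpan_insert_ne_top {E : Type*} [AddCommGroup E] [Module ℝ E]
    {S : AffineSubspace ℝ E}
    (hS : finrank ℝ S.direction + 1 < finrank ℝ E) (y : E) :
    affineSpan ℝ (insert y (S : Set E)) ≠ ⊤ := by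
  intro h
  have h1 := finrank_vectorSpan_insert_le S y
  rw [← direction_affineSpan, h, AffineSubspace.direction_top, finrank_top] at h1
  omega

theorem ne_top_of_finrank_direction {E : Type*} [AddCommGroup E] [Module ℝ E]
    {S : AffineSubspace ℝ E}
    (hS : finrank ℝ S.direction + 1 < finrank ℝ E) : S ≠ ⊤ := by
  rintro rfl
  rw [AffineSubspace.direction_top, finrank_top] at hS
  omega

variable {E : Type*} [NormedAddCommGroup E] [NormedSpace ℝ E] [FiniteDimensional ℝ E]

theorem exists_mem_open_forall_notMem_affineSubspace {U : Set E} (hU : IsOpen U)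
    (hne : U.Nonempty) {ℱ : Set (AffineSubspace ℝ E)} (hℱ : ℱ.Finite) (h : ∀ S ∈ ℱ, S ≠ ⊤) :
    ∃ x ∈ U, ∀ S ∈ ℱ, x ∉ S := by
  let _ : MeasurableSpace E := borel E
  have : BorelSpace E := ⟨rfl⟩
  let μ : MeasureTheory.Measure E := MeasureTheory.Measure.addHaar
  have h0 : μ (⋃ S ∈ ℱ, (S : Set E)) = 0 :=
    (MeasureTheory.measure_biUnion_null_iff hℱ.countable).2 fun S hS =>
      MeasureTheory.Measure.addHaar_affineSubspace μ S (h S hS)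
  by_contra! hcon
  refine (hU.measure_pos μ hne).ne' (MeasureTheory.measure_mono_null (fun x hx => ?_) h0)
  obtain ⟨S, hS, hxS⟩ := hcon x hx
  exact mem_biUnion hS hxS

/-- A finite union of affine subspaces of codimension at least two does not separate a
convex open set. -/
theorem subset_of_isClosed_of_mem_nhds {B C : Set E} (hB : IsOpen B) (hBc : Convex ℝ B)
    (hC : IsClosed C) {ℱ : Set (AffineSubspace ℝ E)} (hℱ : ℱ.Finite)
    (hcodim : ∀ S ∈ ℱ, finrank ℝ S.direction + 1 < finrank ℝ E)
    (hloc : ∀ y ∈ B, y ∈ C → (∀ S ∈ ℱ, y ∉ S) → C ∈ 𝓝 y)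
    (hne : (B ∩ interior C).Nonempty) : B ⊆ C := by
  by_contra hcon
  rw [Set.not_subset] at hcon
  obtain ⟨y₀, hy₀B, hy₀C⟩ := hcon
  obtain ⟨y, ⟨hyB, hyC⟩, hy⟩ := exists_mem_open_forall_notMem_affineSubspace
    (hB.inter hC.isOpen_compl) ⟨y₀, hy₀B, hy₀C⟩ hℱ
    (fun S hS => ne_top_of_finrank_direction (hcodim S hS))
  obtain ⟨z, ⟨hzB, hzC⟩, hz⟩ := exists_mem_open_forall_notMem_affineSubspace
    (hB.inter isOpen_interior) hne
    (hℱ.image fun S : AffineSubspace ℝ E => affineSpan ℝ (insert y (S : Set E))) (by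
      rintro _ ⟨S, hS, rfl⟩
      exact affineSpan_insert_ne_top (hcodim S hS) y)
  have havoid : ∀ p ∈ segment ℝ y z, ∀ S ∈ ℱ, p ∉ S := by
    intro p hp S hS hpS
    rw [segment_eq_image_lineMap] at hp
    obtain ⟨t, -, rfl⟩ := hp
    rcases eq_or_ne t 0 with rfl | ht
    · exact hy S hS (by simpa using hpS)
    · refine hz _ ⟨S, hS, rfl⟩ ?_
      have h1 : z = AffineMap.lineMap y (AffineMap.lineMap y z t) t⁻¹ := by
        simp [AffineMap.lineMap_apply, smul_smul, inv_mul_cancel₀ ht]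
      rw [h1]
      exact AffineMap.lineMap_mem _ (subset_affineSpan ℝ _ (mem_insert _ _))
        (subset_affineSpan ℝ _ (mem_insert_of_mem _ hpS))
  have hseg : segment ℝ y z ⊆ B := hBc.segment_subset hyB hzB
  obtain ⟨p, -, hp1, hp2⟩ := (convex_segment (𝕜 := ℝ) y z).isPreconnected Cᶜ (interior C)
    hC.isOpen_compl isOpen_interior
    (fun p hp => by
      by_cases hpC : p ∈ C
      · exact Or.inr (mem_interior_iff_mem_nhds.2 (hloc p (hseg hp) hpC (havoid p hp)))
      · exact Or.inl hpC)
    ⟨y, left_mem_segment ℝ y z, hyC⟩ ⟨z, right_mem_segment ℝ y z, hzC⟩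
  exact hp1 (interior_subset hp2)

/-- On a connected set avoiding all coincidence loci, a continuous piecewise affine map is
affine. -/
theorem exists_eqOn_affine_of_isPreconnected {𝒜 : Set (E →ᵃ[ℝ] E)} (h𝒜 : 𝒜.Finite)
    {η : E → E} {P : Set E} (hP : IsPreconnected P) (hne : P.Nonempty) (hη : ContinuousOn η P)
    (hp : ∀ y ∈ P, ∃ A ∈ 𝒜, η y = A y)
    (hsep : ∀ y ∈ P, ∀ A ∈ 𝒜, ∀ B ∈ 𝒜, A y = B y → A = B) :
    ∃ A ∈ 𝒜, EqOn η A P := by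
  obtain ⟨p, hpP⟩ := hne
  obtain ⟨A, hA, hpA⟩ := hp p hpP
  have : PreconnectedSpace P := Subtype.preconnectedSpace hP
  have hclosed : ∀ B : E →ᵃ[ℝ] E, IsClosed {y : P | η y = B y} := fun B =>
    isClosed_eq (continuousOn_iff_continuous_domRestrict.1 hη)
      (B.continuous_of_finiteDimensional.comp continuous_subtype_val)
  have hcompl : {y : P | η y = A y}ᶜ = ⋃ B ∈ 𝒜 \ {A}, {y : P | η y = B y} := by
    ext y
    simp only [mem_compl_iff, Set.mem_ofPred_eq, mem_iUnion, Set.mem_sdiff, mem_singleton_iff,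
      exists_prop]
    constructor
    · intro hy
      obtain ⟨B, hB, hyB⟩ := hp y y.2
      exact ⟨B, ⟨hB, fun h => hy (h ▸ hyB)⟩, hyB⟩
    · rintro ⟨B, ⟨hB, hBA⟩, hyB⟩ hyA
      exact hBA (hsep y y.2 B hB A hA (hyB.symm.trans hyA))
  have hclopen : IsClopen {y : P | η y = A y} := by
    refine ⟨hclosed A, isClosed_compl_iff.1 ?_⟩
    rw [hcompl]
    exact (h𝒜.subset sdiff_subset).isClosed_biUnion fun B _ => hclosed B
  have huniv := hclopen.eq_univ ⟨⟨p, hpP⟩, hpA⟩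
  refine ⟨A, hA, fun y hy => ?_⟩
  have : (⟨y, hy⟩ : P) ∈ {y : P | η y = A y} := huniv ▸ mem_univ _
  exact this

theorem AffineMap.isOpenMap_of_injOn {A : E →ᵃ[ℝ] E} {P : Set E} (hP : IsOpen P)
    (hne : P.Nonempty) (hA : InjOn A P) : IsOpenMap A := by
  rw [← AffineMap.isOpenMap_linear_iff]
  refine A.linear.isOpenMap_of_finiteDimensional (LinearMap.injective_iff_surjective.1 ?_)
  rw [injective_iff_map_eq_zero]
  intro v hv
  obtain ⟨p, hp⟩ := hne
  have h1 : Tendsto (fun t : ℝ => p + t • v) (𝓝[≠] 0) (𝓝 p) := by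
    have : Tendsto (fun t : ℝ => p + t • v) (𝓝 0) (𝓝 (p + (0:ℝ) • v)) :=
      Continuous.tendsto (by fun_prop) 0
    rw [zero_smul, add_zero] at this
    exact this.mono_left nhdsWithin_le_nhds
  obtain ⟨t, ht, ht0⟩ := ((h1.eventually (hP.mem_nhds hp)).and self_mem_nhdsWithin).exists
  have h2 : A (p + t • v) = A p := by
    rw [add_comm, ← vadd_eq_add, AffineMap.map_vadd, map_smul, hv]; simp
  have h3 := hA ht hp h2
  simpa [show t ≠ 0 from ht0] using h3

/-- If all coincidence loci near `x` lie in the hyperplane `ℓ = ℓ x`, a continuous injective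
piecewise affine map is affine and open on the closed half ball `ℓ x ≤ ℓ`. -/
theorem exists_eq_affine_on_half_ball {𝒜 : Set (E →ᵃ[ℝ] E)} (h𝒜 : 𝒜.Finite) {η : E → E}
    {x : E} {δ : ℝ} (hδ : 0 < δ) (hη : ContinuousOn η (ball x δ)) (hinj : InjOn η (ball x δ))
    (hp : ∀ y ∈ ball x δ, ∃ A ∈ 𝒜, η y = A y) {l : E →ₗ[ℝ] ℝ} (hl : l ≠ 0)
    (hsep : ∀ y ∈ ball x δ, ∀ A ∈ 𝒜, ∀ B ∈ 𝒜, A ≠ B → A y = B y → l y = l x) :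
    ∃ A : E →ᵃ[ℝ] E, IsOpenMap A ∧ ∀ y ∈ ball x δ, l x ≤ l y → η y = A y := by
  have hlc : Continuous l := l.continuous_of_finiteDimensional
  obtain ⟨v, hv⟩ : ∃ v, l v = 1 := by
    obtain ⟨u, hu⟩ : ∃ u, l u ≠ 0 := by
      by_contra! h
      exact hl (LinearMap.ext h)
    exact ⟨(l u)⁻¹ • u, by simp [hu]⟩
  set P : Set E := ball x δ ∩ {y | l x < l y} with hPdef
  have hPo : IsOpen P := isOpen_ball.inter (isOpen_lt continuous_const hlc)
  have hPc : Convex ℝ P := (convex_ball x δ).inter (convex_halfSpace_gt l.isLinear _)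
  have happroach : ∀ y ∈ ball x δ, l x ≤ l y →
      Tendsto (fun t : ℝ => y + t • v) (𝓝[>] 0) (𝓝[P] y) := by
    intro y hy hxy
    have : Tendsto (fun t : ℝ => y + t • v) (𝓝 0) (𝓝 (y + (0:ℝ) • v)) :=
      Continuous.tendsto (by fun_prop) 0
    rw [zero_smul, add_zero] at this
    have h1 := this.mono_left (nhdsWithin_le_nhds (s := Ioi 0))
    refine tendsto_nhdsWithin_iff.2 ⟨h1, ?_⟩
    filter_upwards [h1.eventually (isOpen_ball.mem_nhds hy), self_mem_nhdsWithin] with t ht ht0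
    refine ⟨ht, ?_⟩
    have : (0:ℝ) < t := ht0
    simp only [Set.mem_ofPred_eq, map_add, map_smul, hv, smul_eq_mul]
    linarith
  have hPne : P.Nonempty := by
    have h1 := happroach x (mem_ball_self hδ) le_rfl
    obtain ⟨t, ht⟩ := (h1.eventually self_mem_nhdsWithin).exists
    exact ⟨_, ht⟩
  have hPsub : P ⊆ ball x δ := inter_subset_left
  obtain ⟨A, -, hA⟩ := exists_eqOn_affine_of_isPreconnected h𝒜 hPc.isPreconnected hPne
    (hη.mono hPsub) (fun y hy => hp y (hPsub hy)) (fun y hy A hA B hB hAB => by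
      by_contra hne
      exact (ne_of_gt hy.2) (hsep y hy.1 A hA B hB hne hAB))
  refine ⟨A, AffineMap.isOpenMap_of_injOn hPo hPne ((hinj.mono hPsub).congr hA), ?_⟩
  intro y hy hxy
  have h1 := happroach y hy hxy
  have h2 : Tendsto (fun t : ℝ => η (y + t • v)) (𝓝[>] 0) (𝓝 (η y)) :=
    ((hη y hy).mono hPsub).tendsto.comp h1
  have h3 : Tendsto (fun t : ℝ => A (y + t • v)) (𝓝[>] 0) (𝓝 (A y)) :=
    (A.continuous_of_finiteDimensional.tendsto y).comp (h1.mono_right nhdsWithin_le_nhds)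
  refine tendsto_nhds_unique_of_eventuallyEq h2 h3 ?_
  filter_upwards [h1.eventually self_mem_nhdsWithin] with t ht using hA ht

/-- A continuous injective piecewise affine map is open at points lying on at most one
coincidence locus. -/
theorem image_mem_nhds_of_subsingleton_locus [Nontrivial E] {𝒜 : Set (E →ᵃ[ℝ] E)}
    (h𝒜 : 𝒜.Finite) {η : E → E} {U : Set E} {x : E} (hU : U ∈ 𝓝 x)
    (hη : ContinuousOn η U) (hinj : InjOn η U) (hp : ∀ y ∈ U, ∃ A ∈ 𝒜, η y = A y)
    (hx : ∀ A ∈ 𝒜, ∀ B ∈ 𝒜, ∀ C ∈ 𝒜, ∀ D ∈ 𝒜, A ≠ B → C ≠ D → A x = B x → C x = D x →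
      affineEqLocus A B = affineEqLocus C D) :
    η '' U ∈ 𝓝 (η x) := by
  obtain ⟨l, hl, hlocus⟩ : ∃ l : E →ₗ[ℝ] ℝ, l ≠ 0 ∧ ∀ A ∈ 𝒜, ∀ B ∈ 𝒜, A ≠ B → A x = B x →
      ∀ y, A y = B y → l y = l x := by
    by_cases h : ∃ A ∈ 𝒜, ∃ B ∈ 𝒜, A ≠ B ∧ A x = B x
    · obtain ⟨A, hA, B, hB, hAB, hABx⟩ := h
      have hlt : (affineEqLocus A B).direction < ⊤ := by
        rw [lt_top_iff_ne_top, Ne, AffineSubspace.direction_eq_top_iff_of_nonempty ⟨x, hABx⟩]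
        exact affineEqLocus_ne_top hAB
      obtain ⟨l, hl, hker⟩ := Submodule.exists_le_ker_of_lt_top _ hlt
      refine ⟨l, hl, fun C hC D hD hCD hCDx y hy => ?_⟩
      have hy' : y ∈ affineEqLocus A B := by
        rw [hx A hA B hB C hC D hD hAB hCD hABx hCDx]; exact hy
      have := hker (AffineSubspace.vsub_mem_direction hy' (mem_affineEqLocus.2 hABx))
      rw [LinearMap.mem_ker, vsub_eq_sub, map_sub] at this
      linarith
    · push Not at h
      obtain ⟨l, hl, -⟩ := Submodule.exists_le_ker_of_lt_top (⊥ : Submodule ℝ E) bot_lt_top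
      exact ⟨l, hl, fun A hA B hB hAB hABx => absurd hABx (h A hA B hB hAB)⟩
  have hev : ∀ᶠ y in 𝓝 x, ∀ A ∈ 𝒜, ∀ B ∈ 𝒜, A y = B y → A x = B x := by
    refine (eventually_all_finite h𝒜).2 fun A _ => (eventually_all_finite h𝒜).2 fun B _ => ?_
    by_cases h : A x = B x
    · exact Eventually.of_forall fun _ _ => h
    · filter_upwards [((A.continuous_of_finiteDimensional.tendsto x).sub
        (B.continuous_of_finiteDimensional.tendsto x)).eventually_ne (sub_ne_zero.2 h)]
        with y hy h' using absurd h' (sub_ne_zero.1 hy)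
  obtain ⟨δ, hδ, hball⟩ := Metric.mem_nhds_iff.1 (inter_mem hU hev)
  have hballU : ball x δ ⊆ U := fun y hy => (hball hy).1
  have hsep : ∀ y ∈ ball x δ, ∀ A ∈ 𝒜, ∀ B ∈ 𝒜, A ≠ B → A y = B y → l y = l x :=
    fun y hy A hA B hB hne h => hlocus A hA B hB hne ((hball hy).2 A hA B hB h) y h
  obtain ⟨A, hAo, hA⟩ := exists_eq_affine_on_half_ball h𝒜 hδ (hη.mono hballU)
    (hinj.mono hballU) (fun y hy => hp y (hballU hy)) hl hsep
  obtain ⟨B, hBo, hB⟩ := exists_eq_affine_on_half_ball h𝒜 hδ (hη.mono hballU)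
    (hinj.mono hballU) (fun y hy => hp y (hballU hy)) (neg_ne_zero.2 hl)
    (fun y hy A hA B hB hne h => by simp [hsep y hy A hA B hB hne h])
  have hxA := hA x (mem_ball_self hδ) le_rfl
  have hxB := hB x (mem_ball_self hδ) le_rfl
  have hnA : A '' ball x δ ∈ 𝓝 (η x) := hxA ▸ hAo.image_mem_nhds (ball_mem_nhds x hδ)
  have hnB : B '' ball x δ ∈ 𝓝 (η x) := hxB ▸ hBo.image_mem_nhds (ball_mem_nhds x hδ)
  filter_upwards [hnA, hnB]
  rintro y ⟨a, ha, rfl⟩ ⟨b, hb, hab⟩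
  rcases le_or_gt (l x) (l a) with h1 | h1
  · exact ⟨a, hballU ha, hA a ha h1⟩
  rcases le_or_gt (l b) (l x) with h2 | h2
  · exact ⟨b, hballU hb, (hB b hb (by simpa using h2)).trans hab⟩
  exfalso
  have hrefl : ∀ c ∈ ball x δ, x + (x - c) ∈ ball x δ := by
    intro c hc
    rw [mem_ball, dist_eq_norm, add_sub_cancel_left, ← dist_eq_norm, dist_comm]
    exact hc
  have hmap : ∀ (T : E →ᵃ[ℝ] E) (c : E), T (x + (x - c)) = T x + (T x - T c) := by
    intro T c
    rw [add_comm, ← vadd_eq_add, AffineMap.map_vadd, ← vsub_eq_sub x c, AffineMap.linearMap_vsub,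
      vsub_eq_sub, vadd_eq_add, add_comm]
  have h3 : η (x + (x - a)) = η (x + (x - b)) := by
    rw [hA _ (hrefl a ha) (by simp only [map_add, map_sub]; linarith),
      hB _ (hrefl b hb) (by simp only [LinearMap.neg_apply, map_add, map_sub]; linarith),
      hmap, hmap, hab, ← hxA, ← hxB]
  have h4 := hinj (hballU (hrefl a ha)) (hballU (hrefl b hb)) h3
  have h5 : a = b := by simpa using h4
  rw [h5] at h1
  linarith

/-- Invariance of domain for a piecewise affine map with a continuous local left inverse. -/
theorem image_closedBall_mem_nhds_of_piecewise_affine [Nontrivial E] {𝒜 : Set (E →ᵃ[ℝ] E)}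
    (h𝒜 : 𝒜.Finite) {η θ : E → E} {w : E} {r : ℝ} (hr : 0 < r)
    (hη : ContinuousOn η (closedBall w r)) (hηw : η w = w) (hθ : ContinuousAt θ w)
    (hθη : ∀ x ∈ closedBall w r, θ (η x) = x)
    (hp : ∀ x ∈ closedBall w r, ∃ A ∈ 𝒜, η x = A x) :
    η '' closedBall w r ∈ 𝓝 w := by
  have : ProperSpace E := FiniteDimensional.proper ℝ E
  have hwK : w ∈ closedBall w r := mem_closedBall_self hr.le
  have hθw : θ w = w := by simpa [hηw] using hθη w hwK
  have hinj : InjOn η (closedBall w r) := fun x hx y hy h => by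
    rw [← hθη x hx, h, hθη y hy]
  have hC : IsClosed (η '' closedBall w r) :=
    ((isCompact_closedBall w r).image_of_continuousOn hη).isClosed
  obtain ⟨ε, hε, hball⟩ := Metric.mem_nhds_iff.1
    (hθ.preimage_mem_nhds (hθw.symm ▸ ball_mem_nhds w hr))
  set 𝓔 : Set (AffineSubspace ℝ E) :=
    image2 affineEqLocus 𝒜 𝒜 \ {⊤}
  have h𝓔fin : 𝓔.Finite := (h𝒜.image2 _ h𝒜).subset sdiff_subset
  set 𝒮 : Set (AffineSubspace ℝ E) :=
    {S | ∃ S₁ ∈ 𝓔, ∃ S₂ ∈ 𝓔, S₁ ≠ S₂ ∧ (∃ x, x ∈ S₁ ∧ x ∈ S₂) ∧ S₁ ⊓ S₂ = S}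
  have h𝒮fin : 𝒮.Finite := (h𝓔fin.image2 (· ⊓ ·) h𝓔fin).subset (by
    rintro S ⟨S₁, h₁, S₂, h₂, -, -, rfl⟩
    exact ⟨S₁, h₁, S₂, h₂, rfl⟩)
  have hcodim : ∀ S ∈ 𝒮, finrank ℝ S.direction + 1 < finrank ℝ E := by
    have key : ∀ S₁ S₂ : AffineSubspace ℝ E, S₁ ≠ ⊤ → ∀ x, x ∈ S₁ → x ∈ S₂ →
        ¬ S₁ ≤ S₂ → finrank ℝ (S₁ ⊓ S₂).direction + 1 < finrank ℝ E := by
      intro S₁ S₂ h₁ x hx₁ hx₂ hle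
      have hlt₁ : S₁.direction < ⊤ := by
        rwa [lt_top_iff_ne_top, Ne, AffineSubspace.direction_eq_top_iff_of_nonempty ⟨x, hx₁⟩]
      have hlt : (S₁ ⊓ S₂).direction < S₁.direction :=
        AffineSubspace.direction_lt_of_nonempty (lt_of_le_of_ne inf_le_left
          (fun h => hle (inf_eq_left.1 h))) ⟨x, hx₁, hx₂⟩
      have h1 := Submodule.finrank_lt_finrank_of_lt hlt
      have h2 := Submodule.finrank_lt_finrank_of_lt hlt₁
      rw [finrank_top] at h2
      omega
    rintro S ⟨S₁, h₁, S₂, h₂, hne, ⟨x, hx₁, hx₂⟩, rfl⟩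
    by_cases hle : S₁ ≤ S₂
    · rw [inf_comm]
      exact key S₂ S₁ h₂.2 x hx₂ hx₁ fun h => hne (le_antisymm hle h)
    · exact key S₁ S₂ h₁.2 x hx₁ hx₂ hle
  have hopen : ∀ x ∈ ball w r, (∀ S ∈ 𝒮, x ∉ S) → η '' closedBall w r ∈ 𝓝 (η x) := by
    intro x hx hxS
    refine image_mem_nhds_of_subsingleton_locus h𝒜
      (mem_of_superset (isOpen_ball.mem_nhds hx) ball_subset_closedBall) hη hinj hp ?_
    intro A hA B hB C hC D hD hAB hCD hABx hCDx
    by_contra hne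
    exact hxS _ ⟨_, ⟨⟨A, hA, B, hB, rfl⟩, affineEqLocus_ne_top hAB⟩,
      _, ⟨⟨C, hC, D, hD, rfl⟩, affineEqLocus_ne_top hCD⟩, hne, ⟨x, hABx, hCDx⟩, rfl⟩
      ⟨hABx, hCDx⟩
  refine mem_of_superset (ball_mem_nhds w hε) (subset_of_isClosed_of_mem_nhds isOpen_ball
    (convex_ball w ε) hC
    (h𝒜.image2 (fun (A : E →ᵃ[ℝ] E) S => S.map A) h𝒮fin) ?_ ?_ ?_)
  · rintro _ ⟨A, -, S, hS, rfl⟩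
    rw [AffineSubspace.map_direction]
    exact lt_of_le_of_lt (Nat.add_le_add_right (Submodule.finrank_map_le _ _) 1) (hcodim S hS)
  · rintro _ hyB ⟨x, hx, rfl⟩ hy
    have hx' : x ∈ ball w r := by
      have := hball hyB
      rwa [mem_preimage, hθη x hx, hθw] at this
    refine hopen x hx' fun S hS hxS => ?_
    obtain ⟨A, hA, hxA⟩ := hp x hx
    exact hy _ ⟨A, hA, S, hS, rfl⟩ (hxA ▸ AffineSubspace.mem_map_of_mem A hxS)
  · have hpre : η ⁻¹' ball w ε ∩ ball w r ∈ 𝓝 w :=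
      inter_mem ((hη.continuousAt (closedBall_mem_nhds w hr)).preimage_mem_nhds
        (hηw.symm ▸ ball_mem_nhds w hε)) (ball_mem_nhds w hr)
    obtain ⟨x, hx, hxS⟩ := exists_mem_open_forall_notMem_affineSubspace isOpen_interior
      ⟨w, mem_interior_iff_mem_nhds.2 hpre⟩ h𝒮fin
      fun S hS => ne_top_of_finrank_direction (hcodim S hS)
    have hx' := interior_subset hx
    exact ⟨η x, hx'.1, mem_interior_iff_mem_nhds.2 (hopen x hx'.2 hxS)⟩

end PiecewiseAffine

section Germs

open Topology Filter

variable {n : ℕ}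

theorem isMcNaughton_of_finite {ι : Type*} [Finite ι] {f : (Fin n → ℝ) → ℝ}
    (hf : ContinuousOn f (cube n)) (h01 : ∀ x ∈ cube n, f x ∈ Icc (0:ℝ) 1)
    (p : ι → (Fin n → ℝ) → ℝ) (hp : ∀ j, IsAffineZ (p j)) (h : ∀ x ∈ cube n, ∃ j, f x = p j x) :
    IsMcNaughton f := by
  obtain ⟨u, ⟨e⟩⟩ := Finite.exists_equiv_fin ι
  refine ⟨hf, h01, u, fun j => p (e.symm j), fun j => hp _, fun x hx => ?_⟩
  obtain ⟨j, hj⟩ := h x hx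
  exact ⟨e j, by simpa using hj⟩

theorem isAffineZ_int (m : ℤ) : IsAffineZ fun _ : Fin n → ℝ => (m : ℝ) :=
  ⟨m, 0, by simp⟩

theorem IsAffineZ.add {p q : (Fin n → ℝ) → ℝ} (hp : IsAffineZ p) (hq : IsAffineZ q) :
    IsAffineZ fun x => p x + q x := by
  obtain ⟨m, c, h⟩ := hp
  obtain ⟨m', c', h'⟩ := hq
  refine ⟨m + m', c + c', fun x => ?_⟩
  simp only [h, h', Pi.add_apply, Int.cast_add, add_mul, Finset.sum_add_distrib]
  ring

theorem IsAffineZ.neg {p : (Fin n → ℝ) → ℝ} (hp : IsAffineZ p) : IsAffineZ fun x => -p x := by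
  obtain ⟨m, c, h⟩ := hp
  refine ⟨-m, -c, fun x => ?_⟩
  simp only [h, Pi.neg_apply, Int.cast_neg, neg_mul, Finset.sum_neg_distrib]
  ring

theorem IsAffineZ.exists_affineMap {p : (Fin n → ℝ) → ℝ} (hp : IsAffineZ p) :
    ∃ A : (Fin n → ℝ) →ᵃ[ℝ] ℝ, ∀ x, A x = p x := by
  obtain ⟨m, c, h⟩ := hp
  refine ⟨AffineMap.const ℝ _ (m : ℝ) +
    (∑ i, (c i : ℝ) • LinearMap.proj i : (Fin n → ℝ) →ₗ[ℝ] ℝ).toAffineMap, fun x => ?_⟩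
  simp [h]

theorem mvNeg_mem_McN {f : ↥(cube n) → ℝ} (hf : f ∈ McN (cube n)) : mvNeg f ∈ McN (cube n) := by
  obtain ⟨F, ⟨hF, h01, u, p, hp, hpF⟩, hfF⟩ := hf
  refine ⟨fun x => 1 - F x, isMcNaughton_of_finite (continuousOn_const.sub hF) (fun x hx => ?_)
    (fun j x => ((1 : ℤ) : ℝ) + -p j x) (fun j => (isAffineZ_int 1).add (hp j).neg)
    (fun x hx => ?_), fun x => by simp [mvNeg, hfF]⟩
  · have := h01 x hx
    constructor <;> linarith [this.1, this.2]
  · obtain ⟨j, hj⟩ := hpF x hx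
    exact ⟨j, by rw [hj]; push_cast; ring⟩

theorem mvOplus_mem_McN {f g : ↥(cube n) → ℝ} (hf : f ∈ McN (cube n)) (hg : g ∈ McN (cube n)) :
    mvOplus f g ∈ McN (cube n) := by
  obtain ⟨F, ⟨hF, hF01, u, p, hp, hpF⟩, hfF⟩ := hf
  obtain ⟨G, ⟨hG, hG01, v, q, hq, hqG⟩, hgG⟩ := hg
  refine ⟨fun x => min 1 (F x + G x), isMcNaughton_of_finite (ι := Option (Fin u × Fin v))
    (continuousOn_const.inf (hF.add hG)) (fun x hx => ?_)
    (fun j x => j.elim ((1 : ℤ) : ℝ) fun k => p k.1 x + q k.2 x) ?_ (fun x hx => ?_),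
    fun x => by simp [mvOplus, hfF, hgG]⟩
  · have h1 := (hF01 x hx).1
    have h2 := (hG01 x hx).1
    exact ⟨le_min zero_le_one (by linarith), min_le_left _ _⟩
  · rintro (_ | k)
    · exact isAffineZ_int 1
    · exact (hp k.1).add (hq k.2)
  · rcases min_choice 1 (F x + G x) with h | h
    · exact ⟨none, by simp [h]⟩
    · obtain ⟨j, hj⟩ := hpF x hx
      obtain ⟨k, hk⟩ := hqG x hx
      exact ⟨some (j, k), h.trans (by rw [hj, hk]; rfl)⟩

theorem MVGen.mem_McN {f : ↥(cube n) → ℝ} (hf : MVGen f) : f ∈ McN (cube n) := by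
  induction hf with
  | zero =>
    exact ⟨fun _ => 0, isMcNaughton_of_finite (ι := Unit) continuousOn_const (by simp)
      (fun _ _ => ((0 : ℤ) : ℝ)) (fun _ => isAffineZ_int 0) (by simp), fun _ => rfl⟩
  | coord i =>
    refine ⟨fun x => x i, isMcNaughton_of_finite (ι := Unit)
      (continuous_apply i).continuousOn (fun x hx => ⟨hx.1 i, hx.2 i⟩) (fun _ x => x i)
      (fun _ => ⟨0, Pi.single i 1, fun x => ?_⟩) (by simp), fun _ => rfl⟩
    simp [Pi.single_apply]
  | neg _ ih => exact mvNeg_mem_McN ih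
  | oplus _ _ ih₁ ih₂ => exact mvOplus_mem_McN ih₁ ih₂

theorem germEq_iff_eventuallyEq {w : ↥(cube n)} {f g : ↥(cube n) → ℝ} :
    germEq w.1 f g ↔ f =ᶠ[𝓝 w] g := by
  rw [Filter.EventuallyEq, nhds_subtype_eq_comap, Filter.eventually_comap]
  constructor
  · rintro ⟨U, hU, hwU, h⟩
    filter_upwards [hU.mem_nhds hwU]
    rintro y hy x rfl
    exact h x hy
  · intro h
    obtain ⟨U, hUs, hU, hwU⟩ := mem_nhds_iff.1 h
    exact ⟨U, hU, hwU, fun x hx => hUs hx x rfl⟩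

/-- Distinct points of the cube are separated by a McNaughton function vanishing near the
first one. -/
theorem exists_mvGen_eventually_zero {a b : ↥(cube n)} (h : a ≠ b) :
    ∃ f, MVGen f ∧ f =ᶠ[𝓝 a] (fun _ => 0) ∧ f b ≠ 0 := by
  obtain ⟨c, m, ha, hb⟩ : ∃ (c : Fin n → ℤ) (m : ℤ), (m : ℝ) + ∑ i, (c i : ℝ) * a.1 i < 0 ∧
      0 < (m : ℝ) + ∑ i, (c i : ℝ) * b.1 i := by
    obtain ⟨i, hi⟩ : ∃ i, a.1 i ≠ b.1 i := by
      by_contra! hcon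
      exact h (Subtype.ext (funext hcon))
    have hden : ∀ q : ℚ, (0:ℝ) < q.den := fun q => by exact_mod_cast q.den_pos
    have hval : ∀ q : ℚ, (q : ℝ) * q.den = q.num := fun q => by
      exact_mod_cast q.mul_den_eq_num
    rcases lt_or_gt_of_ne hi with hlt | hlt
    · obtain ⟨q, hq1, hq2⟩ := exists_rat_btwn hlt
      refine ⟨Pi.single i q.den, -q.num, ?_, ?_⟩ <;>
      · simp only [Pi.single_apply, Int.cast_ite, Int.cast_natCast, Int.cast_zero, ite_mul,
          zero_mul, Finset.sum_ite_eq', Finset.mem_univ, if_true, Int.cast_neg]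
        nlinarith [hden q, hval q]
    · obtain ⟨q, hq1, hq2⟩ := exists_rat_btwn hlt
      refine ⟨Pi.single i (-q.den), q.num, ?_, ?_⟩ <;>
      · simp only [Pi.single_apply, Int.cast_ite, Int.cast_natCast, Int.cast_zero, ite_mul,
          zero_mul, Finset.sum_ite_eq', Finset.mem_univ, if_true, Int.cast_neg]
        nlinarith [hden q, hval q]
  refine ⟨_, MVGen.trunc_affine c m, ?_, ?_⟩
  · have hc : Continuous fun x : ↥(cube n) => (m : ℝ) + ∑ i, (c i : ℝ) * x.1 i :=
      continuous_const.add (continuous_finsetSum _ fun i _ =>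
        continuous_const.mul ((continuous_apply i).comp continuous_subtype_val))
    filter_upwards [hc.continuousAt.eventually_lt_const ha] with x hx
    exact max_eq_left ((min_le_right _ _).trans hx.le)
  · exact (lt_max_of_lt_right (lt_min one_pos hb)).ne'

/-- Tuples of McNaughton functions are piecewise affine self-maps of the cube. -/
theorem exists_finite_affine_of_isMcNaughton {F : Fin n → (Fin n → ℝ) → ℝ}
    (hF : ∀ i, IsMcNaughton (F i)) :
    ∃ 𝒜 : Set ((Fin n → ℝ) →ᵃ[ℝ] (Fin n → ℝ)), 𝒜.Finite ∧
      ∀ x ∈ cube n, ∃ A ∈ 𝒜, (fun i => F i x) = A x := by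
  choose _ _ u p hp hpF using hF
  choose A hA using fun i j => (hp i j).exists_affineMap
  refine ⟨Set.range fun J : ∀ i, Fin (u i) => AffineMap.pi fun i => A i (J i),
    Set.finite_range _, fun x hx => ?_⟩
  choose J hJ using fun i => hpF i x hx
  refine ⟨_, ⟨J, rfl⟩, funext fun i => ?_⟩
  rw [hJ]
  exact (hA i (J i) x).symm

end Germs

/-- for a rational point `w` in the open cube `(0,1)^n`, the germinal
MV-algebra `A_w = McN([0,1]^n)/𝔬_w` is hopfian. The endomorphism of `A_w` is presented by
a map `σ` on representatives which respects germ equivalence and is an MV-homomorphism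
modulo germ equivalence; surjectivity and injectivity are likewise modulo germ
equivalence. -/
theorem stmt9 {n : ℕ} (hn : 1 ≤ n) (w : Fin n → ℝ) (hwrat : IsRationalPoint w)
    (hwint : ∀ i, w i ∈ Set.Ioo (0:ℝ) 1)
    (σ : (↥(cube n) → ℝ) → (↥(cube n) → ℝ))
    (hmaps : Set.MapsTo σ (McN (cube n)) (McN (cube n)))
    (hresp : ∀ f ∈ McN (cube n), ∀ g ∈ McN (cube n), germEq w f g → germEq w (σ f) (σ g))
    (hzero : germEq w (σ (fun _ => 0)) (fun _ => 0))
    (hneg : ∀ f ∈ McN (cube n), germEq w (σ (mvNeg f)) (mvNeg (σ f)))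
    (hoplus : ∀ f ∈ McN (cube n), ∀ g ∈ McN (cube n),
      germEq w (σ (mvOplus f g)) (mvOplus (σ f) (σ g)))
    (hsurj : ∀ g ∈ McN (cube n), ∃ f ∈ McN (cube n), germEq w (σ f) g) :
    ∀ f ∈ McN (cube n), ∀ g ∈ McN (cube n), germEq w (σ f) (σ g) → germEq w f g := by
  have : Nonempty (Fin n) := ⟨⟨0, hn⟩⟩
  have hwcube : cube n ∈ nhds w := by
    rw [cube, ← Set.pi_univ_Icc]
    exact set_pi_mem_nhds Set.finite_univ fun i _ => Icc_mem_nhds (hwint i).1 (hwint i).2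
  obtain ⟨a, rfl⟩ : ∃ a : ↥(cube n), a.1 = w := ⟨⟨w, mem_of_mem_nhds hwcube⟩, rfl⟩
  simp only [germEq_iff_eventuallyEq] at *
  have hnhds : Filter.map Subtype.val (nhds a) = nhds a.1 :=
    map_nhds_subtype_coe_eq_nhds a.2 hwcube
  choose F hF hσF using fun i => hmaps (MVGen.coord (n := n) i).mem_McN
  have hFcube : ∀ x ∈ cube n, (fun i => F i x) ∈ cube n := fun x hx =>
    ⟨fun i => ((hF i).2.1 x hx).1, fun i => ((hF i).2.1 x hx).2⟩
  have hFcont : ContinuousOn (fun x i => F i x) (cube n) :=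
    continuousOn_pi.2 fun i => (hF i).1
  set η : ↥(cube n) → ↥(cube n) := fun x => ⟨fun i => F i x.1, hFcube x.1 x.2⟩ with hη
  have hηcont : Continuous η :=
    (continuousOn_iff_continuous_domRestrict.1 hFcont).subtype_mk _
  have hcomp : ∀ f, MVGen f → σ f =ᶠ[nhds a] f ∘ η := by
    intro f hf
    induction hf with
    | zero => exact hzero
    | coord i => exact Filter.Eventually.of_forall fun x => hσF i x
    | @neg f hf ih =>
      filter_upwards [hneg f hf.mem_McN, ih] with x h1 h2
      simp [h1, mvNeg, h2]
    | @oplus f g hf hg ih₁ ih₂ =>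
      filter_upwards [hoplus f hf.mem_McN g hg.mem_McN, ih₁, ih₂] with x h1 h2 h3
      simp [h1, mvOplus, h2, h3]
  have hηa : η a = a := by
    by_contra hne
    obtain ⟨f, hf, hf0, hfη⟩ := exists_mvGen_eventually_zero (Ne.symm hne)
    have h1 := hresp f hf.mem_McN _ MVGen.zero.mem_McN hf0
    exact hfη (((hcomp f hf).symm.trans (h1.trans hzero)).eq_of_nhds)
  choose g' hg' hσg using fun i => hsurj _ (MVGen.coord (n := n) i).mem_McN
  choose G hG hgG using hg'
  have hGcont : ContinuousOn (fun x i => G i x) (cube n) :=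
    continuousOn_pi.2 fun i => (hG i).1
  have hleft : ∀ᶠ x in nhds a, (fun i => G i (η x).1) = x.1 := by
    have : ∀ᶠ x in nhds a, ∀ i, g' i (η x) = x.1 i := by
      rw [Filter.eventually_all]
      intro i
      filter_upwards [hσg i, hcomp _ (mvGen_of_mem_McN ⟨G i, hG i, hgG i⟩)] with x h1 h2
      rw [← h1, h2, Function.comp_apply]
    filter_upwards [this] with x hx
    funext i
    rw [← hgG, hx]
  intro f hf g hg hfg
  have hfgη : ∀ᶠ x in nhds a, f (η x) = g (η x) := by
    filter_upwards [hcomp f (mvGen_of_mem_McN hf), hcomp g (mvGen_of_mem_McN hg), hfg]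
      with x h1 h2 h3
    exact h1.symm.trans (h3.trans h2)
  have hall : ∀ᶠ y in nhds a.1, ∃ x : ↥(cube n), x.1 = y ∧
      (fun i => G i (η x).1) = x.1 ∧ f (η x) = g (η x) := by
    rw [← hnhds, Filter.eventually_map]
    filter_upwards [hleft, hfgη] with x h1 h2 using ⟨x, rfl, h1, h2⟩
  obtain ⟨r, hr, hball⟩ := Metric.nhds_basis_closedBall.mem_iff.1 hall
  have hsub : Metric.closedBall a.1 r ⊆ cube n := fun y hy => by
    obtain ⟨x, rfl, -⟩ := hball hy
    exact x.2
  obtain ⟨𝒜, h𝒜, hA⟩ := exists_finite_affine_of_isMcNaughton hF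
  have himage := image_closedBall_mem_nhds_of_piecewise_affine h𝒜 (η := fun x i => F i x)
    (θ := fun x i => G i x) hr (hFcont.mono hsub) (congrArg Subtype.val hηa)
    (hGcont.continuousAt hwcube)
    (fun y hy => by
      obtain ⟨x, rfl, hx, -⟩ := hball hy
      exact hx)
    (fun y hy => hA y (hsub hy))
  rw [← hnhds, Filter.mem_map] at himage
  filter_upwards [himage] with x hx
  obtain ⟨y, hy, hyx⟩ := hx
  obtain ⟨z, rfl, -, hz⟩ := hball hy
  have : η z = x := Subtype.ext hyx
  rwa [this] at hz
end

section
/- Let X ⊆ [0,1] be a nonempty closed set. Then McN(X) is hopfian: every surjective MV-endomorphism of McN(X) is injective. (This is the concrete form of the statement that every one-generator semisimple MV-algebra is hopfian; note that in general the rational points of X need not be dense in X, so this is not a consequence of residual finiteness.) -/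
/-- An (affine) linear polynomial in one variable with integer coefficients. -/
def IsAffineZ1 (p : ℝ → ℝ) : Prop := ∃ m c : ℤ, ∀ x, p x = (m : ℝ) + (c : ℝ) * x

/-- A McNaughton function on `[0,1]`: continuous, `[0,1]`-valued, and agreeing at each
point of `[0,1]` with one of finitely many affine polynomials with integer coefficients. -/
def IsMcNaughton1 (f : ℝ → ℝ) : Prop :=
  ContinuousOn f (Set.Icc 0 1) ∧ (∀ x ∈ Set.Icc (0:ℝ) 1, f x ∈ Set.Icc (0:ℝ) 1) ∧
  ∃ (u : ℕ) (p : Fin u → ℝ → ℝ),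
    (∀ j, IsAffineZ1 (p j)) ∧ ∀ x ∈ Set.Icc (0:ℝ) 1, ∃ j, f x = p j x

/-- `McN1 X`: restrictions to `X ⊆ [0,1]` of McNaughton functions on `[0,1]`. -/
def McN1 (X : Set ℝ) : Set (↥X → ℝ) :=
  {g : ↥X → ℝ | ∃ f, IsMcNaughton1 f ∧ ∀ x : X, g x = f x.1}

theorem IsMcNaughton1.of_finite {f : ℝ → ℝ} {ι : Type*} [Finite ι]
    (hf : ContinuousOn f (Set.Icc 0 1)) (hI : ∀ x ∈ Set.Icc (0:ℝ) 1, f x ∈ Set.Icc (0:ℝ) 1)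
    (p : ι → ℝ → ℝ) (hp : ∀ j, IsAffineZ1 (p j))
    (h : ∀ x ∈ Set.Icc (0:ℝ) 1, ∃ j, f x = p j x) : IsMcNaughton1 f := by
  obtain ⟨u, ⟨e⟩⟩ := Finite.exists_equiv_fin ι
  refine ⟨hf, hI, u, fun j => p (e.symm j), fun j => hp _, fun x hx => ?_⟩
  obtain ⟨j, hj⟩ := h x hx
  exact ⟨e j, by simpa using hj⟩

theorem isMcNaughton1_zero : IsMcNaughton1 (fun _ => 0) :=
  .of_finite (ι := Unit) continuousOn_const (fun _ _ => ⟨le_rfl, zero_le_one⟩)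
    (fun _ _ => 0) (fun _ => ⟨0, 0, by simp⟩) (fun _ _ => ⟨(), rfl⟩)

theorem isMcNaughton1_id : IsMcNaughton1 (fun x => x) :=
  .of_finite (ι := Unit) continuousOn_id (fun _ hx => hx)
    (fun _ x => x) (fun _ => ⟨0, 1, by simp⟩) (fun _ _ => ⟨(), rfl⟩)

theorem IsMcNaughton1.mvNeg {f : ℝ → ℝ} (hf : IsMcNaughton1 f) : IsMcNaughton1 (mvNeg f) := by
  obtain ⟨hc, hI, u, p, hp, h⟩ := hf
  refine .of_finite (continuousOn_const.sub hc) (fun x hx => ?_) (fun j => _root_.mvNeg (p j))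
    (fun j => ?_) (fun x hx => ?_)
  · have := hI x hx
    exact ⟨by simpa [_root_.mvNeg] using this.2, by simpa [_root_.mvNeg] using this.1⟩
  · obtain ⟨m, c, hmc⟩ := hp j
    exact ⟨1 - m, -c, fun x => by simp only [_root_.mvNeg, hmc]; push_cast; ring⟩
  · obtain ⟨j, hj⟩ := h x hx
    exact ⟨j, by simp only [_root_.mvNeg, hj]⟩

theorem IsMcNaughton1.mvOplus {f g : ℝ → ℝ} (hf : IsMcNaughton1 f) (hg : IsMcNaughton1 g) :
    IsMcNaughton1 (mvOplus f g) := by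
  obtain ⟨hfc, hfI, u, p, hp, hfp⟩ := hf
  obtain ⟨hgc, hgI, v, q, hq, hgq⟩ := hg
  refine .of_finite (ι := Option (Fin u × Fin v)) (continuousOn_const.inf (hfc.add hgc))
    (fun x hx => ?_) (fun j x => j.elim 1 (fun i => p i.1 x + q i.2 x)) (fun j => ?_)
    (fun x hx => ?_)
  · exact ⟨le_min zero_le_one (add_nonneg (hfI x hx).1 (hgI x hx).1), min_le_left _ _⟩
  · rcases j with _ | ⟨i, k⟩
    · exact ⟨1, 0, by simp⟩
    · obtain ⟨m, c, hmc⟩ := hp i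
      obtain ⟨m', c', hmc'⟩ := hq k
      exact ⟨m + m', c + c', fun x => by simp only [Option.elim, hmc, hmc']; push_cast; ring⟩
  · obtain ⟨i, hi⟩ := hfp x hx
    obtain ⟨k, hk⟩ := hgq x hx
    rcases min_choice 1 (f x + g x) with h | h
    · exact ⟨none, h⟩
    · exact ⟨some (i, k), by simpa only [_root_.mvOplus, Option.elim, ← hi, ← hk] using h⟩

section McN1

variable {X : Set ℝ}

theorem zero_mem_McN1 : (fun _ => 0) ∈ McN1 X := ⟨_, isMcNaughton1_zero, fun _ => rfl⟩

theorem coe_mem_McN1 : (fun x : X => (x : ℝ)) ∈ McN1 X := ⟨_, isMcNaughton1_id, fun _ => rfl⟩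

theorem mvNeg_mem_McN1 {f : X → ℝ} (hf : f ∈ McN1 X) : mvNeg f ∈ McN1 X := by
  obtain ⟨F, hF, h⟩ := hf
  exact ⟨_, hF.mvNeg, fun x => by simp only [mvNeg, h]⟩

theorem mvOplus_mem_McN1 {f g : X → ℝ} (hf : f ∈ McN1 X) (hg : g ∈ McN1 X) :
    mvOplus f g ∈ McN1 X := by
  obtain ⟨F, hF, hf⟩ := hf
  obtain ⟨G, hG, hg⟩ := hg
  exact ⟨_, hF.mvOplus hG, fun x => by simp only [mvOplus, hf, hg]⟩

theorem mem_Icc_of_mem_McN1 (hX : X ⊆ Set.Icc 0 1) {f : X → ℝ} (hf : f ∈ McN1 X) (x : X) :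
    f x ∈ Set.Icc (0:ℝ) 1 := by
  obtain ⟨F, hF, h⟩ := hf
  exact h x ▸ hF.2.1 x (hX x.2)

theorem continuous_of_mem_McN1 (hX : X ⊆ Set.Icc 0 1) {f : X → ℝ} (hf : f ∈ McN1 X) :
    Continuous f := by
  obtain ⟨F, hF, h⟩ := hf
  rw [show f = X.domRestrict F from funext h]
  exact (hF.1.mono hX).domRestrict

theorem exists_affine_of_mem_McN1 (hX : X ⊆ Set.Icc 0 1) {f : X → ℝ} (hf : f ∈ McN1 X) (x : X) :
    ∃ m c : ℤ, f x = m + c * x := by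
  obtain ⟨F, hF, h⟩ := hf
  obtain ⟨u, p, hp, hFp⟩ := hF.2.2
  obtain ⟨j, hj⟩ := hFp x (hX x.2)
  obtain ⟨m, c, hmc⟩ := hp j
  exact ⟨m, c, by rw [h, hj, hmc]⟩

/-- An MV-homomorphism from `McN1 X` to the standard MV-algebra `[0,1]`. -/
structure IsMVHom (X : Set ℝ) (h : (X → ℝ) → ℝ) : Prop where
  mem_Icc : ∀ f ∈ McN1 X, h f ∈ Set.Icc (0:ℝ) 1
  map_zero : h (fun _ => 0) = 0
  map_neg : ∀ f ∈ McN1 X, h (mvNeg f) = 1 - h f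
  map_oplus : ∀ f ∈ McN1 X, ∀ g ∈ McN1 X, h (mvOplus f g) = min 1 (h f + h g)

namespace IsMVHom

variable {h : (X → ℝ) → ℝ}

/-- The kernel of an MV-homomorphism has no strictly positive element. -/
theorem not_forall_pos (hh : IsMVHom X h) (hX : X ⊆ Set.Icc 0 1) (hcl : IsClosed X)
    (hne : X.Nonempty) {f : X → ℝ} (hf : f ∈ McN1 X) (h0 : h f = 0) : ¬ ∀ x, 0 < f x := by
  intro hpos
  have : CompactSpace X := isCompact_iff_compactSpace.mp (isCompact_Icc.of_isClosed_subset hcl hX)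
  have : Nonempty X := hne.to_subtype
  obtain ⟨a, -, ha⟩ := isCompact_univ.exists_isMinOn Set.univ_nonempty
    (continuous_of_mem_McN1 hX hf).continuousOn
  have multiples : ∀ n : ℕ, ∃ g ∈ McN1 X, h g = 0 ∧ ∀ x, min 1 (n * f a) ≤ g x := by
    intro n
    induction n with
    | zero => exact ⟨_, zero_mem_McN1, hh.map_zero, fun x => by simp⟩
    | succ n ih =>
      obtain ⟨g, hg, hg0, hgx⟩ := ih
      refine ⟨_, mvOplus_mem_McN1 hg hf, by rw [hh.map_oplus g hg f hf, hg0, h0]; simp,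
        fun x => ?_⟩
      have h1 := hgx x
      have h2 : f a ≤ f x := ha (Set.mem_univ x)
      have h3 := hpos a
      push_cast
      simp only [mvOplus]
      rcases min_cases 1 (n * f a) with h | h <;> rcases min_cases 1 (g x + f x) with h' | h' <;>
        rcases min_cases 1 ((n + 1) * f a) with h'' | h'' <;> linarith
  obtain ⟨n, hn⟩ := exists_nat_gt (1 / f a)
  obtain ⟨g, hg, hg0, hgx⟩ := multiples n
  have hn' : 1 < n * f a := by rwa [div_lt_iff₀ (hpos a)] at hn
  have hg1 : g = mvNeg (fun _ => 0) := by
    funext x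
    have := hgx x
    rw [min_eq_left hn'.le] at this
    simpa [mvNeg] using le_antisymm (mem_Icc_of_mem_McN1 hX hg x).2 this
  rw [hg1, hh.map_neg _ zero_mem_McN1, hh.map_zero] at hg0
  norm_num at hg0

theorem exists_common_zero (hh : IsMVHom X h) (hX : X ⊆ Set.Icc 0 1) (hcl : IsClosed X)
    (hne : X.Nonempty) : ∃ a : X, ∀ f ∈ McN1 X, h f = 0 → f a = 0 := by
  by_contra! hcon
  have : CompactSpace X := isCompact_iff_compactSpace.mp (isCompact_Icc.of_isClosed_subset hcl hX)
  have key : ∃ f ∈ McN1 X, h f = 0 ∧ ∀ x ∈ (Set.univ : Set X), 0 < f x := by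
    refine isCompact_univ.induction_on (p := fun s => ∃ f ∈ McN1 X, h f = 0 ∧ ∀ x ∈ s, 0 < f x)
      ⟨_, zero_mem_McN1, hh.map_zero, by simp⟩ ?_ ?_ ?_
    · rintro s t hst ⟨f, hf, h0, hft⟩
      exact ⟨f, hf, h0, fun x hx => hft x (hst hx)⟩
    · rintro s t ⟨f, hf, hf0, hfs⟩ ⟨g, hg, hg0, hgt⟩
      refine ⟨_, mvOplus_mem_McN1 hf hg, by rw [hh.map_oplus f hf g hg, hf0, hg0]; simp, ?_⟩
      rintro x (hx | hx)
      · exact lt_min one_pos (add_pos_of_pos_of_nonneg (hfs x hx) (mem_Icc_of_mem_McN1 hX hg x).1)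
      · exact lt_min one_pos (add_pos_of_nonneg_of_pos (mem_Icc_of_mem_McN1 hX hf x).1 (hgt x hx))
    · intro a _
      obtain ⟨f, hf, h0, hfa⟩ := hcon a
      have hpos : 0 < f a := lt_of_le_of_ne (mem_Icc_of_mem_McN1 hX hf a).1 hfa.symm
      exact ⟨{x | 0 < f x}, mem_nhdsWithin_of_mem_nhds
        ((isOpen_lt continuous_const (continuous_of_mem_McN1 hX hf)).mem_nhds hpos),
        f, hf, h0, fun x hx => hx⟩
  obtain ⟨f, hf, h0, hpos⟩ := key
  exact hh.not_forall_pos hX hcl hne hf h0 fun x => hpos x trivial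

theorem le_of_common_zero (hh : IsMVHom X h) (hX : X ⊆ Set.Icc 0 1) {a : X}
    (ha : ∀ f ∈ McN1 X, h f = 0 → f a = 0) {f : X → ℝ} (hf : f ∈ McN1 X) : f a ≤ h f := by
  have gap : ∀ n : ℕ, ∀ f ∈ McN1 X, ¬ 1 < 2 ^ n * (f a - h f) := by
    intro n
    induction n with
    | zero =>
      intro f hf hlt
      have := (mem_Icc_of_mem_McN1 hX hf a).2
      have := (hh.mem_Icc f hf).1
      linarith
    | succ n ih =>
      intro f hf hlt
      have hlt' : 1 < 2 ^ n * (2 * (f a - h f)) := by rw [pow_succ] at hlt; linarith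
      have hpos : 0 < f a - h f := by
        by_contra hle
        have : 2 ^ n * (2 * (f a - h f)) ≤ 0 :=
          mul_nonpos_of_nonneg_of_nonpos (by positivity) (by linarith)
        linarith
      rcases le_or_gt (f a) (1 / 2) with hs | hs
      · refine ih _ (mvOplus_mem_McN1 hf hf) ?_
        rw [hh.map_oplus f hf f hf]
        simp only [mvOplus]
        rw [min_eq_right (by linarith), min_eq_right (by linarith)]
        convert hlt' using 2
        ring
      · have hn := mvNeg_mem_McN1 hf
        have hE := mvNeg_mem_McN1 (mvOplus_mem_McN1 hn hn)
        have hEh : h (mvNeg (mvOplus (mvNeg f) (mvNeg f))) =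
            1 - min 1 (1 - h f + (1 - h f)) := by
          rw [hh.map_neg _ (mvOplus_mem_McN1 hn hn), hh.map_oplus _ hn _ hn, hh.map_neg f hf]
        have hEa : mvNeg (mvOplus (mvNeg f) (mvNeg f)) a = 2 * f a - 1 := by
          simp only [mvNeg, mvOplus]
          rw [min_eq_right (by linarith)]
          ring
        rcases le_total (h f) (1 / 2) with hr | hr
        · have h0 := ha _ hE (by rw [hEh, min_eq_left (by linarith)]; ring)
          linarith
        · refine ih _ hE ?_
          rw [hEh, hEa, min_eq_right (by linarith)]
          convert hlt' using 2
          ring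
  by_contra! hlt
  obtain ⟨n, hn⟩ := pow_unbounded_of_one_lt (1 / (f a - h f)) (one_lt_two (α := ℝ))
  exact gap n f hf (by rwa [div_lt_iff₀ (by linarith)] at hn)

/-- Every MV-homomorphism from `McN1 X` to `[0,1]` is the evaluation at a point of `X`. -/
theorem exists_eq_eval (hh : IsMVHom X h) (hX : X ⊆ Set.Icc 0 1) (hcl : IsClosed X)
    (hne : X.Nonempty) : ∃ a : X, ∀ f ∈ McN1 X, h f = f a := by
  obtain ⟨a, ha⟩ := hh.exists_common_zero hX hcl hne
  refine ⟨a, fun f hf => le_antisymm ?_ (hh.le_of_common_zero hX ha hf)⟩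
  have := hh.le_of_common_zero hX ha (mvNeg_mem_McN1 hf)
  rw [hh.map_neg f hf] at this
  simp only [mvNeg] at this
  linarith

end IsMVHom

end McN1

/-- An irrational point of `[0,1]` and its image under an invertible integral affine map
with image in `[0,1]` agree up to the reflection `x ↦ 1 - x`. -/
theorem eq_or_eq_one_sub_of_affine {x y : ℝ} (hx : Irrational x) (hxI : x ∈ Set.Icc (0:ℝ) 1)
    (hyI : y ∈ Set.Icc (0:ℝ) 1) {m c m' c' : ℤ} (hy : y = m + c * x) (hx' : x = m' + c' * y) :
    y = x ∨ y = 1 - x := by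
  have hx0 : 0 < x := lt_of_le_of_ne hxI.1 hx.ne_zero.symm
  have hx1 : x < 1 := lt_of_le_of_ne hxI.2 hx.ne_one
  have hcc : c' * c = 1 := by
    by_contra hcc
    have hd : (1 - c' * c : ℤ) ≠ 0 := by omega
    refine (hx.intCast_mul hd).ne_int (m' + c' * m) ?_
    push_cast
    linear_combination hx' + (c' : ℝ) * hy
  rcases Int.eq_one_or_neg_one_of_mul_eq_one' hcc with ⟨-, rfl⟩ | ⟨-, rfl⟩
  · have h1 : (-1 : ℝ) < m := by push_cast at hy; linarith [hyI.1]
    have h2 : (m : ℝ) < 1 := by push_cast at hy; linarith [hyI.2]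
    have hm : m = 0 := by
      have h1' : -1 < m := by exact_mod_cast h1
      have h2' : m < 1 := by exact_mod_cast h2
      omega
    exact .inl (by rw [hy, hm]; simp)
  · have h1 : (0 : ℝ) < m := by push_cast at hy; linarith [hyI.1]
    have h2 : (m : ℝ) < 2 := by push_cast at hy; linarith [hyI.2]
    have hm : m = 1 := by
      have h1' : 0 < m := by exact_mod_cast h1
      have h2' : m < 2 := by exact_mod_cast h2
      omega
    exact .inr (by rw [hy, hm]; push_cast; ring)

/-- A self-map of `X ⊆ [0,1]` which is pointwise given by integral affine maps and has a left
inverse pointwise given by integral affine maps is surjective. -/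
theorem surjective_of_affine {X : Set ℝ} (hX : X ⊆ Set.Icc 0 1) {η : X → X}
    (hinj : Function.Injective η) (hη : ∀ y : X, ∃ m c : ℤ, (η y : ℝ) = m + c * y)
    (hη' : ∀ y : X, ∃ m c : ℤ, (y : ℝ) = m + c * η y) : Function.Surjective η := by
  intro x
  suffices ∃ S : Set ℝ, S.Finite ∧ (x : ℝ) ∈ S ∧ ∀ y : X, (y : ℝ) ∈ S → (η y : ℝ) ∈ S by
    obtain ⟨S, hS, hxS, hmap⟩ := this
    have hfin : ((↑) ⁻¹' S : Set X).Finite := hS.preimage Subtype.val_injective.injOn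
    have himage := Set.eq_of_subset_of_ncard_le
      (show η '' ((↑) ⁻¹' S : Set X) ⊆ (↑) ⁻¹' S from Set.image_subset_iff.mpr hmap)
      (Set.ncard_image_of_injective _ hinj).ge hfin
    obtain ⟨y, -, hy⟩ : x ∈ η '' ((↑) ⁻¹' S : Set X) := himage.symm.subset hxS
    exact ⟨y, hy⟩
  by_cases hx : Irrational (x : ℝ)
  · refine ⟨{(x : ℝ), 1 - (x : ℝ)}, Set.toFinite _, by simp, fun y hy => ?_⟩
    have hyirr : Irrational (y : ℝ) := by
      rcases hy with hy | hy
      · rwa [hy]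
      · rw [Set.mem_singleton_iff.mp hy]
        exact_mod_cast hx.intCast_sub 1
    obtain ⟨m, c, hmc⟩ := hη y
    obtain ⟨m', c', hmc'⟩ := hη' y
    have := eq_or_eq_one_sub_of_affine hyirr (hX y.2) (hX (η y).2) hmc hmc'
    simp only [Set.mem_insert_iff, Set.mem_singleton_iff] at hy ⊢
    rcases hy with hy | hy <;> rcases this with h | h <;> rw [h, hy] <;> simp
  · obtain ⟨q, hq⟩ : ∃ q : ℚ, (q : ℝ) = x := by simpa [Irrational] using hx
    have hd : (0 : ℝ) < q.den := by exact_mod_cast q.den_pos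
    have hgrid : ∀ y : X, (∃ k : ℤ, (y : ℝ) * q.den = k) →
        (y : ℝ) ∈ (fun k : ℤ => (k : ℝ) / q.den) '' Set.Icc 0 (q.den : ℤ) := by
      rintro y ⟨k, hk⟩
      have hyI := hX y.2
      refine ⟨k, ⟨?_, ?_⟩, by simp only [← hk]; field_simp⟩
      · have : (0 : ℝ) ≤ k := hk ▸ mul_nonneg hyI.1 hd.le
        exact_mod_cast this
      · have : (k : ℝ) ≤ q.den := hk ▸ mul_le_of_le_one_left hd.le hyI.2
        exact_mod_cast this
    refine ⟨_, (Set.finite_Icc 0 (q.den : ℤ)).image (fun k : ℤ => (k : ℝ) / q.den),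
      hgrid x ⟨q.num, ?_⟩, ?_⟩
    · rw [← hq]
      exact_mod_cast q.mul_den_eq_num
    · rintro y ⟨k, -, hk⟩
      obtain ⟨m, c, hmc⟩ := hη y
      refine hgrid _ ⟨m * q.den + c * k, ?_⟩
      rw [hmc, ← hk]
      push_cast
      field_simp

/-- for every nonempty closed `X ⊆ [0,1]`, the one-generator semisimple
MV-algebra `McN(X)` is hopfian: every surjective MV-endomorphism is injective. -/
theorem stmt12 (X : Set ℝ) (hXc : X ⊆ Set.Icc 0 1) (hcl : IsClosed X) (hne : X.Nonempty) :
    ∀ σ : (↥X → ℝ) → (↥X → ℝ),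
      Set.MapsTo σ (McN1 X) (McN1 X) →
      σ (fun _ => 0) = (fun _ => 0) →
      (∀ f ∈ McN1 X, σ (mvNeg f) = mvNeg (σ f)) →
      (∀ f ∈ McN1 X, ∀ g ∈ McN1 X, σ (mvOplus f g) = mvOplus (σ f) (σ g)) →
      Set.SurjOn σ (McN1 X) (McN1 X) → Set.InjOn σ (McN1 X) := by
  intro σ hmaps h0 hneg hplus hsurj
  have heval : ∀ y : X, ∃ a : X, ∀ f ∈ McN1 X, σ f y = f a := fun y =>
    IsMVHom.exists_eq_eval (h := fun f => σ f y)
      ⟨fun f hf => mem_Icc_of_mem_McN1 hXc (hmaps hf) y, congrFun h0 y,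
        fun f hf => congrFun (hneg f hf) y, fun f hf g hg => congrFun (hplus f hf g hg) y⟩
      hXc hcl hne
  choose η hη using heval
  obtain ⟨g, hg, hσg⟩ := hsurj coe_mem_McN1
  have hleft : ∀ y : X, g (η y) = y := fun y => by rw [← hη y g hg, hσg]
  have hηsurj : Function.Surjective η := by
    refine surjective_of_affine hXc (fun y z hyz => ?_) (fun y => ?_) (fun y => ?_)
    · exact Subtype.ext (by rw [← hleft y, ← hleft z, hyz])
    · rw [← hη y _ coe_mem_McN1]
      exact exists_affine_of_mem_McN1 hXc (hmaps coe_mem_McN1) y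
    · obtain ⟨m, c, hmc⟩ := exists_affine_of_mem_McN1 hXc hg (η y)
      exact ⟨m, c, by rw [← hmc, hleft]⟩
  intro f hf f' hf' hff'
  funext x
  obtain ⟨y, rfl⟩ := hηsurj x
  rw [← hη y f hf, ← hη y f' hf', hff']
end
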